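/- arXiv:1811.00741 — 7 statements merged into one kernel-verified Lean document; each statement's English description precedes it below -/
import Mathlib

section
/- Let G ⊆ ℝ^n, let G̃ = {α • g : 0 ≤ α ≤ 1, g ∈ G} be the scaled set of G, and suppose the Carathéodory number of G̃ is at most c. If a vector v can be written as a sum v = g₁ + ⋯ + g_m of m (not necessarily distinct) elements of G, then there exist at most c elements h₁, …, h_c ∈ G and nonnegative real coefficients β₁, …, β_c with β₁ + ⋯ + β_c ≤ m such that v = β₁ • h₁ + ⋯ + β_c • h_c. -/
/-- The Carathéodory number of `G` is at most `c`: every point of the convex hull of `G`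
is a convex combination of at most `c` points of `G` (padding with zero weights allows
us to use exactly `c` points). -/
def CarNumberLE {E : Type*} [AddCommGroup E] [Module ℝ E] (G : Set E) (c : ℕ) : Prop :=
  ∀ v ∈ convexHull ℝ G, ∃ (p : Fin c → E) (w : Fin c → ℝ),
    (∀ i, p i ∈ G) ∧ (∀ i, 0 ≤ w i) ∧ (∑ i, w i) = 1 ∧ v = ∑ i, w i • p i

/-- If the scaled set `G̃ = {α • g : 0 ≤ α ≤ 1, g ∈ G}` of `G ⊆ ℝ^n` has Carathéodory
number at most `c`, then any sum `v` of `m` (not necessarily distinct) elements of `G`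
can be rewritten as `v = β₁ • h₁ + ⋯ + β_c • h_c` with `hᵢ ∈ G`, `βᵢ ≥ 0` and
`β₁ + ⋯ + β_c ≤ m`. -/
theorem sum_eq_nonneg_comb_of_scaled_carNumber_le
    {n : ℕ} (G : Set (EuclideanSpace ℝ (Fin n))) (c : ℕ)
    (hcar : CarNumberLE
      {g : EuclideanSpace ℝ (Fin n) |
        ∃ (α : ℝ) (x : EuclideanSpace ℝ (Fin n)), 0 ≤ α ∧ α ≤ 1 ∧ x ∈ G ∧ g = α • x} c)
    (m : ℕ) (g : Fin m → EuclideanSpace ℝ (Fin n)) (hg : ∀ i, g i ∈ G)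
    (v : EuclideanSpace ℝ (Fin n)) (hv : v = ∑ i, g i) :
    ∃ (h : Fin c → EuclideanSpace ℝ (Fin n)) (β : Fin c → ℝ),
      (∀ i, 0 ≤ β i) ∧ (∑ i, β i) ≤ (m : ℝ) ∧
      (∀ i, β i ≠ 0 → h i ∈ G) ∧
      v = ∑ i, β i • h i := by
  subst hv
  rcases Nat.eq_zero_or_pos m with hm | hm
  · subst hm
    exact ⟨fun _ => 0, fun _ => 0, by simp, by simp, by simp, by simp⟩
  have hm' : (0 : ℝ) < m := by exact_mod_cast hm
  obtain ⟨p, w, hp, hw, hw1, hsum⟩ := hcar (∑ i, (m : ℝ)⁻¹ • g i) (by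
    apply (convex_convexHull ℝ _).sum_mem
    · intro i _
      positivity
    · simp [hm'.ne']
    · intro i _
      exact subset_convexHull ℝ _ ⟨1, g i, by simp, le_refl _, hg i, by simp⟩)
  choose α x hα0 hα1 hx hpx using hp
  refine ⟨x, fun i => m * (w i * α i), fun i => ?_, ?_, fun i _ => hx i, ?_⟩
  · exact mul_nonneg hm'.le (mul_nonneg (hw i) (hα0 i))
  · rw [← Finset.mul_sum]
    have h1 : ∑ i, w i * α i ≤ ∑ i, w i :=
      Finset.sum_le_sum fun i _ => mul_le_of_le_one_right (hw i) (hα1 i)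
    rw [hw1] at h1
    exact mul_le_of_le_one_right hm'.le h1
  · have h2 : ∑ i, g i = (m : ℝ) • ∑ i, (m : ℝ)⁻¹ • g i := by
      rw [← Finset.smul_sum, smul_inv_smul₀ hm'.ne']
    rw [h2, hsum, Finset.smul_sum]
    refine Finset.sum_congr rfl fun i _ => ?_
    rw [hpx i, smul_smul, smul_smul, mul_assoc]
end

section
/- Let θ ∈ ℝ^d and let F₊, F₋ ⊆ ℝ^d be convex sets. Define G̃ = {−α y x : 0 ≤ α ≤ 1, y ∈ {−1, +1}, x ∈ F_y, y ⟨θ, x⟩ ≤ 1}. Then the Carathéodory number of G̃ is at most 2: every point in conv(G̃) can be written as a convex combination of at most 2 points of G̃, one arising from each class. -/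
open scoped RealInnerProductSpace

/-- The scaled subgradients arising from one class. -/
def classSub {d : ℕ} (θ : EuclideanSpace ℝ (Fin d)) (y : ℝ)
    (F : Set (EuclideanSpace ℝ (Fin d))) : Set (EuclideanSpace ℝ (Fin d)) :=
  {g | ∃ (α : ℝ) (x : EuclideanSpace ℝ (Fin d)), 0 ≤ α ∧ α ≤ 1 ∧ x ∈ F ∧ y * ⟪θ, x⟫ ≤ 1 ∧
    g = (-(α * y)) • x}

theorem classSub_convex {d : ℕ} (θ : EuclideanSpace ℝ (Fin d)) (y : ℝ)
    (F : Set (EuclideanSpace ℝ (Fin d))) (hF : Convex ℝ F) : Convex ℝ (classSub θ y F) := by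
  rintro _ ⟨α, x, h0, h1, hx, hθ, rfl⟩ _ ⟨β, z, k0, k1, hz, kθ, rfl⟩ a b ha hb hab
  have haα : 0 ≤ a * α := mul_nonneg ha h0
  have hbβ : 0 ≤ b * β := mul_nonneg hb k0
  rcases (add_nonneg haα hbβ).eq_or_lt with hs | hs
  · have e1 : a * α = 0 := by linarith
    have e2 : b * β = 0 := by linarith
    refine ⟨0, x, le_rfl, zero_le_one, hx, hθ, ?_⟩
    have e3 : a * (-(α * y)) = 0 := by linear_combination (-y) * e1
    have e4 : b * (-(β * y)) = 0 := by linear_combination (-y) * e2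
    simp only [smul_smul, e3, e4]
    simp
  · set s := a * α + b * β with hsdef
    have hne : s ≠ 0 := hs.ne'
    have hsum : a * α / s + b * β / s = 1 := by rw [← add_div]; exact div_self hne
    have p1 : 0 ≤ a * α / s := div_nonneg haα hs.le
    have p2 : 0 ≤ b * β / s := div_nonneg hbβ hs.le
    refine ⟨s, (a * α / s) • x + (b * β / s) • z, hs.le, ?_, hF hx hz p1 p2 hsum, ?_, ?_⟩
    · nlinarith
    · rw [inner_add_right, inner_smul_right, inner_smul_right]
      nlinarith [mul_le_mul_of_nonneg_left hθ p1, mul_le_mul_of_nonneg_left kθ p2]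
    · rw [smul_add, smul_smul, smul_smul, smul_smul, smul_smul]
      congr 2 <;> field_simp

/-- For a binary SVM with hinge loss and convex per-class feasible slices `F₊, F₋`,
the set of scaled subgradients
`G̃ = {−α y x : 0 ≤ α ≤ 1, y ∈ {−1,+1}, x ∈ F_y, y⟨θ,x⟩ ≤ 1}` has Carathéodory number
at most `2`: every point of `conv(G̃)` is a convex combination of at most `2` points
of `G̃`. -/
theorem svm_scaled_subgradients_carNumber_le_two
    {d : ℕ} (θ : EuclideanSpace ℝ (Fin d))
    (Fp Fm : Set (EuclideanSpace ℝ (Fin d)))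
    (hFp : Convex ℝ Fp) (hFm : Convex ℝ Fm) :
    ∀ v ∈ convexHull ℝ {g : EuclideanSpace ℝ (Fin d) |
        ∃ (α y : ℝ) (x : EuclideanSpace ℝ (Fin d)), 0 ≤ α ∧ α ≤ 1 ∧
          ((y = 1 ∧ x ∈ Fp) ∨ (y = -1 ∧ x ∈ Fm)) ∧ y * ⟪θ, x⟫ ≤ 1 ∧
          g = (-(α * y)) • x},
      ∃ (p : Fin 2 → EuclideanSpace ℝ (Fin d)) (w : Fin 2 → ℝ),
        (∀ i, p i ∈ {g : EuclideanSpace ℝ (Fin d) |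
            ∃ (α y : ℝ) (x : EuclideanSpace ℝ (Fin d)), 0 ≤ α ∧ α ≤ 1 ∧
              ((y = 1 ∧ x ∈ Fp) ∨ (y = -1 ∧ x ∈ Fm)) ∧ y * ⟪θ, x⟫ ≤ 1 ∧
              g = (-(α * y)) • x}) ∧
        (∀ i, 0 ≤ w i) ∧ (∑ i, w i) = 1 ∧ v = ∑ i, w i • p i := by
  intro v hv
  have hG : {g : EuclideanSpace ℝ (Fin d) |
        ∃ (α y : ℝ) (x : EuclideanSpace ℝ (Fin d)), 0 ≤ α ∧ α ≤ 1 ∧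
          ((y = 1 ∧ x ∈ Fp) ∨ (y = -1 ∧ x ∈ Fm)) ∧ y * ⟪θ, x⟫ ≤ 1 ∧
          g = (-(α * y)) • x} = classSub θ 1 Fp ∪ classSub θ (-1) Fm := by
    ext g
    constructor
    · rintro ⟨α, y, x, h0, h1, ⟨rfl, hx⟩ | ⟨rfl, hx⟩, h, e⟩
      · exact Or.inl ⟨α, x, h0, h1, hx, h, e⟩
      · exact Or.inr ⟨α, x, h0, h1, hx, h, e⟩
    · rintro (⟨α, x, h0, h1, hx, h, e⟩ | ⟨α, x, h0, h1, hx, h, e⟩)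
      · exact ⟨α, 1, x, h0, h1, Or.inl ⟨rfl, hx⟩, h, e⟩
      · exact ⟨α, -1, x, h0, h1, Or.inr ⟨rfl, hx⟩, h, e⟩
  rw [hG] at hv ⊢
  have c1 := classSub_convex θ 1 Fp hFp
  have c2 := classSub_convex θ (-1) Fm hFm
  have key : ∃ p ∈ classSub θ 1 Fp ∪ classSub θ (-1) Fm,
      ∃ q ∈ classSub θ 1 Fp ∪ classSub θ (-1) Fm, v ∈ segment ℝ p q := by
    rcases (classSub θ 1 Fp).eq_empty_or_nonempty with h | h
    · rw [h, Set.empty_union, c2.convexHull_eq] at hv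
      exact ⟨v, Or.inr hv, v, Or.inr hv, left_mem_segment ℝ v v⟩
    rcases (classSub θ (-1) Fm).eq_empty_or_nonempty with h' | h'
    · rw [h', Set.union_empty, c1.convexHull_eq] at hv
      exact ⟨v, Or.inl hv, v, Or.inl hv, left_mem_segment ℝ v v⟩
    rw [c1.convexHull_union c2 h h', mem_convexJoin] at hv
    obtain ⟨p, hp, q, hq, hs⟩ := hv
    exact ⟨p, Or.inl hp, q, Or.inr hq, hs⟩
  obtain ⟨p, hp, q, hq, a, b, ha, hb, hab, e⟩ := key
  refine ⟨![p, q], ![a, b], ?_, ?_, ?_, ?_⟩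
  · intro i; fin_cases i
    · exact hp
    · exact hq
  · intro i; fin_cases i
    · exact ha
    · exact hb
  · simpa using hab
  · simpa using e.symm
end

section
/- Let c : ℝ → ℝ be convex, monotone increasing, and twice differentiable, such that c″/c′ is monotone non-increasing (equivalently, log c′ is concave and c′ > 0). Let s₁, s₂ ∈ ℝ, γ ∈ [0, 1], and set T = γ c′(s₁) + (1 − γ) c′(s₂) and s̃ = (γ c′(s₁) s₁ + (1 − γ) c′(s₂) s₂) / T. Then c′(s̃) ≥ T; equivalently, log c′(s̃) ≥ log T. -/
/-- Let `c : ℝ → ℝ` be convex, monotone increasing and twice differentiable with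
`c''/c'` monotone non-increasing. For `s₁ s₂ : ℝ` and `γ ∈ [0,1]`, putting
`T = γ c'(s₁) + (1−γ) c'(s₂)` and `s̃ = (γ c'(s₁) s₁ + (1−γ) c'(s₂) s₂) / T`,
one has `c'(s̃) ≥ T`. -/
theorem deriv_at_weighted_point_ge
    (c c' c'' : ℝ → ℝ)
    (hconv : ConvexOn ℝ Set.univ c)
    (hmono : StrictMono c)
    (hd1 : ∀ v, HasDerivAt c (c' v) v)
    (hd2 : ∀ v, HasDerivAt c' (c'' v) v)
    (hratio : Antitone fun v => c'' v / c' v)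
    (s₁ s₂ γ : ℝ) (hγ0 : 0 ≤ γ) (hγ1 : γ ≤ 1) :
    γ * c' s₁ + (1 - γ) * c' s₂ ≤
      c' ((γ * c' s₁ * s₁ + (1 - γ) * c' s₂ * s₂) / (γ * c' s₁ + (1 - γ) * c' s₂)) := by
  have hpos : ∀ v, 0 < c' v := by
    intro v
    have h := hconv.slope_le_of_hasDerivAt (Set.mem_univ (v - 1)) (Set.mem_univ v)
      (by linarith) (hd1 v)
    have h2 := hmono (show v - 1 < v by linarith)
    rw [slope_def_field] at h
    have h3 : v - (v - 1) = 1 := by ring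
    rw [h3, div_one] at h
    linarith
  have hdl : ∀ v, HasDerivAt (fun x => Real.log (c' x)) (c'' v / c' v) v :=
    fun v => (hd2 v).log (hpos v).ne'
  have hconc : ConcaveOn ℝ Set.univ (fun x => Real.log (c' x)) := by
    apply Antitone.concaveOn_univ_of_deriv (fun v => (hdl v).differentiableAt)
    have : deriv (fun x => Real.log (c' x)) = fun v => c'' v / c' v :=
      funext fun v => (hdl v).deriv
    rw [this]
    exact hratio
  have ha := hpos s₁
  have hb := hpos s₂
  have hδ : 0 ≤ 1 - γ := by linarith
  have hT : 0 < γ * c' s₁ + (1 - γ) * c' s₂ := by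
    rcases hγ0.eq_or_lt with h | h
    · rw [← h]; linarith
    · have := mul_pos h ha
      have := mul_nonneg hδ hb.le
      linarith
  have hx := Real.convexOn_mul_log.2 (Set.mem_Ici.2 ha.le) (Set.mem_Ici.2 hb.le) hγ0 hδ
    (by ring)
  set T := γ * c' s₁ + (1 - γ) * c' s₂ with hTdef
  have hc := hconc.2 (Set.mem_univ s₁) (Set.mem_univ s₂)
    (show 0 ≤ γ * c' s₁ / T by positivity) (show 0 ≤ (1 - γ) * c' s₂ / T by positivity)
    (by rw [← add_div]; exact div_self hT.ne')
  simp only [smul_eq_mul] at hx hc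
  rw [← hTdef] at hx
  have e : γ * c' s₁ / T * s₁ + (1 - γ) * c' s₂ / T * s₂ =
      (γ * c' s₁ * s₁ + (1 - γ) * c' s₂ * s₂) / T := by ring
  rw [e] at hc
  rw [← Real.log_le_log_iff hT (hpos _)]
  refine le_trans ?_ hc
  have e2 : γ * c' s₁ / T * Real.log (c' s₁) + (1 - γ) * c' s₂ / T * Real.log (c' s₂) =
      (γ * (c' s₁ * Real.log (c' s₁)) + (1 - γ) * (c' s₂ * Real.log (c' s₂))) / T := by ring
  rw [e2, le_div_iff₀ hT]
  linarith
end

section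
/- Fix θ ∈ ℝ^d and convex sets F₊, F₋ ⊆ ℝ^d. Define G̃ = {α σ(−y ⟨θ, x⟩)(−y x) : 0 ≤ α ≤ 1, y ∈ {−1, +1}, x ∈ F_y}, where σ(v) = 1/(1 + exp(−v)) is the sigmoid. Then the Carathéodory number of G̃ is at most 2: every point of conv(G̃) is a convex combination of at most 2 points of G̃. -/
open scoped RealInnerProductSpace

/-- The scaled gradients of a single class form a convex set. -/
theorem class_convex {d : ℕ} (θ : EuclideanSpace ℝ (Fin d)) (y : ℝ)
    (F : Set (EuclideanSpace ℝ (Fin d))) (hF : Convex ℝ F) :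
    Convex ℝ {g : EuclideanSpace ℝ (Fin d) |
      ∃ (α : ℝ) (x : EuclideanSpace ℝ (Fin d)), 0 ≤ α ∧ α ≤ 1 ∧ x ∈ F ∧
        g = (α * (1 / (1 + Real.exp (-(-(y * ⟪θ, x⟫)))))) • ((-y) • x)} := by
  rintro _ ⟨α₁, x₁, h0, h1, hx₁, rfl⟩ _ ⟨α₂, x₂, k0, k1, hx₂, rfl⟩ p q hp hq hpq
  simp only [neg_neg]
  set e₁ := Real.exp (y * ⟪θ, x₁⟫) with he₁
  set e₂ := Real.exp (y * ⟪θ, x₂⟫) with he₂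
  have e1pos : 0 < e₁ := Real.exp_pos _
  have e2pos : 0 < e₂ := Real.exp_pos _
  set b₁ := p * (α₁ * (1 / (1 + e₁))) with hb₁
  set b₂ := q * (α₂ * (1 / (1 + e₂))) with hb₂
  have b1n : 0 ≤ b₁ := by positivity
  have b2n : 0 ≤ b₂ := by positivity
  have m1 : b₁ * (1 + e₁) = p * α₁ := by rw [hb₁]; field_simp
  have m2 : b₂ * (1 + e₂) = q * α₂ := by rw [hb₂]; field_simp
  rw [smul_smul p, smul_smul q, ← hb₁, ← hb₂]
  rcases (add_nonneg b1n b2n).eq_or_lt with hb | hb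
  · have z1 : b₁ = 0 := by linarith
    have z2 : b₂ = 0 := by linarith
    exact ⟨0, x₁, le_rfl, zero_le_one, hx₁, by simp [z1, z2]⟩
  · have hs : b₁ / (b₁ + b₂) + b₂ / (b₁ + b₂) = 1 := by field_simp
    have c1 : 0 ≤ b₁ / (b₁ + b₂) := by positivity
    have c2 : 0 ≤ b₂ / (b₁ + b₂) := by positivity
    set x := (b₁ / (b₁ + b₂)) • x₁ + (b₂ / (b₁ + b₂)) • x₂ with hx
    have hexp : Real.exp (y * ⟪θ, x⟫) ≤ b₁ / (b₁ + b₂) * e₁ + b₂ / (b₁ + b₂) * e₂ := by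
      have := convexOn_exp.2 (Set.mem_univ (y * ⟪θ, x₁⟫)) (Set.mem_univ (y * ⟪θ, x₂⟫)) c1 c2 hs
      simp only [smul_eq_mul] at this
      refine le_trans (le_of_eq ?_) this
      rw [hx, inner_add_right, inner_smul_right, inner_smul_right]
      congr 1
      ring
    have hexp' : (b₁ + b₂) * Real.exp (y * ⟪θ, x⟫) ≤ b₁ * e₁ + b₂ * e₂ := by
      calc _ ≤ (b₁ + b₂) * (b₁ / (b₁ + b₂) * e₁ + b₂ / (b₁ + b₂) * e₂) := by gcongr
        _ = _ := by field_simp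
    have epos : 0 < Real.exp (y * ⟪θ, x⟫) := Real.exp_pos _
    refine ⟨(b₁ + b₂) * (1 + Real.exp (y * ⟪θ, x⟫)), x, by positivity, ?_,
      hF hx₁ hx₂ c1 c2 hs, ?_⟩
    · nlinarith
    · have : (b₁ + b₂) * (1 + Real.exp (y * ⟪θ, x⟫)) * (1 / (1 + Real.exp (y * ⟪θ, x⟫)))
          = b₁ + b₂ := by field_simp
      rw [this, hx, smul_add, smul_add, smul_smul, smul_smul, smul_smul, smul_smul, smul_smul,
        smul_smul]
      congr 2 <;> field_simp

/-- For logistic regression with convex per-class feasible slices `F₊, F₋`, the set of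
scaled gradients `G̃ = {α σ(−y⟨θ,x⟩)(−y x) : 0 ≤ α ≤ 1, y ∈ {−1,+1}, x ∈ F_y}`, where
`σ(v) = 1/(1 + exp(−v))` is the sigmoid, has Carathéodory number at most `2`: every
point of `conv(G̃)` is a convex combination of at most `2` points of `G̃`. -/
theorem logistic_scaled_gradients_carNumber_le_two
    {d : ℕ} (θ : EuclideanSpace ℝ (Fin d))
    (Fp Fm : Set (EuclideanSpace ℝ (Fin d)))
    (hFp : Convex ℝ Fp) (hFm : Convex ℝ Fm) :
    ∀ v ∈ convexHull ℝ {g : EuclideanSpace ℝ (Fin d) |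
        ∃ (α y : ℝ) (x : EuclideanSpace ℝ (Fin d)), 0 ≤ α ∧ α ≤ 1 ∧
          ((y = 1 ∧ x ∈ Fp) ∨ (y = -1 ∧ x ∈ Fm)) ∧
          g = (α * (1 / (1 + Real.exp (-(-(y * ⟪θ, x⟫)))))) • ((-y) • x)},
      ∃ (p : Fin 2 → EuclideanSpace ℝ (Fin d)) (w : Fin 2 → ℝ),
        (∀ i, p i ∈ {g : EuclideanSpace ℝ (Fin d) |
            ∃ (α y : ℝ) (x : EuclideanSpace ℝ (Fin d)), 0 ≤ α ∧ α ≤ 1 ∧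
              ((y = 1 ∧ x ∈ Fp) ∨ (y = -1 ∧ x ∈ Fm)) ∧
              g = (α * (1 / (1 + Real.exp (-(-(y * ⟪θ, x⟫)))))) • ((-y) • x)}) ∧
        (∀ i, 0 ≤ w i) ∧ (∑ i, w i) = 1 ∧ v = ∑ i, w i • p i := by
  intro v hv
  have hP := class_convex θ 1 Fp hFp
  have hM := class_convex θ (-1) Fm hFm
  set P := {g : EuclideanSpace ℝ (Fin d) |
      ∃ (α : ℝ) (x : EuclideanSpace ℝ (Fin d)), 0 ≤ α ∧ α ≤ 1 ∧ x ∈ Fp ∧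
        g = (α * (1 / (1 + Real.exp (-(-((1 : ℝ) * ⟪θ, x⟫)))))) • ((-(1 : ℝ)) • x)} with hPdef
  set M := {g : EuclideanSpace ℝ (Fin d) |
      ∃ (α : ℝ) (x : EuclideanSpace ℝ (Fin d)), 0 ≤ α ∧ α ≤ 1 ∧ x ∈ Fm ∧
        g = (α * (1 / (1 + Real.exp (-(-((-1 : ℝ) * ⟪θ, x⟫)))))) • ((-(-1 : ℝ)) • x)} with hMdef
  set G := {g : EuclideanSpace ℝ (Fin d) |
        ∃ (α y : ℝ) (x : EuclideanSpace ℝ (Fin d)), 0 ≤ α ∧ α ≤ 1 ∧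
          ((y = 1 ∧ x ∈ Fp) ∨ (y = -1 ∧ x ∈ Fm)) ∧
          g = (α * (1 / (1 + Real.exp (-(-(y * ⟪θ, x⟫)))))) • ((-y) • x)} with hGdef
  have hG : G = P ∪ M := by
    ext g
    constructor
    · rintro ⟨α, y, x, h0, h1, ⟨rfl, hx⟩ | ⟨rfl, hx⟩, rfl⟩
      · exact Or.inl ⟨α, x, h0, h1, hx, rfl⟩
      · exact Or.inr ⟨α, x, h0, h1, hx, rfl⟩
    · rintro (⟨α, x, h0, h1, hx, rfl⟩ | ⟨α, x, h0, h1, hx, rfl⟩)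
      · exact ⟨α, 1, x, h0, h1, Or.inl ⟨rfl, hx⟩, rfl⟩
      · exact ⟨α, -1, x, h0, h1, Or.inr ⟨rfl, hx⟩, rfl⟩
  clear_value P M G
  subst hG
  have key : ∃ a ∈ P ∪ M, ∃ b ∈ P ∪ M, v ∈ segment ℝ a b := by
    rcases P.eq_empty_or_nonempty with h | hPn
    · rw [h, Set.empty_union, hM.convexHull_eq] at hv
      exact ⟨v, Or.inr hv, v, Or.inr hv, left_mem_segment ℝ v v⟩
    rcases M.eq_empty_or_nonempty with h | hMn
    · rw [h, Set.union_empty, hP.convexHull_eq] at hv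
      exact ⟨v, Or.inl hv, v, Or.inl hv, left_mem_segment ℝ v v⟩
    rw [hP.convexHull_union hM hPn hMn, mem_convexJoin] at hv
    obtain ⟨a, ha, b, hb, h⟩ := hv
    exact ⟨a, Or.inl ha, b, Or.inr hb, h⟩
  obtain ⟨a, ha, b, hb, s, t, hs, ht, hst, rfl⟩ := key
  refine ⟨![a, b], ![s, t], ?_, ?_, ?_, ?_⟩
  · intro i; fin_cases i
    · exact ha
    · exact hb
  · intro i; fin_cases i
    · exact hs
    · exact ht
  · simpa using hst
  · simp
end

section
/- Fix θ ∈ ℝ^d and convex sets F₊, F₋ ⊆ ℝ^d, and let G = {−y x : y ∈ {−1, +1}, x ∈ F_y, y ⟨θ, x⟩ ≤ 1} be the set of nonzero hinge-loss subgradients at θ over the feasible set. Suppose a vector v ∈ ℝ^d can be written as a sum of ñ elements of G (with repetition allowed). Then there exist x̃₊ ∈ F₊ with ⟨θ, x̃₊⟩ ≤ 1, x̃₋ ∈ F₋ with −⟨θ, x̃₋⟩ ≤ 1, and nonnegative reals β₊, β₋ with β₊ + β₋ ≤ ñ, such that v = β₊ (−x̃₊) + β₋ (x̃₋). In other words, any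 hinge-loss poisoning attack with ñ points can be replaced by an attack of total weight at most ñ supported on only 2 distinct points, one from each class. -/
open scoped RealInnerProductSpace

/-- Absorb one more point of a convex set into a weighted point. -/
lemma svm_merge {E : Type*} [AddCommGroup E] [Module ℝ E] {C : Set E} (hC : Convex ℝ C)
    {β : ℝ} (hβ : 0 ≤ β) {x z : E} (hx : β ≠ 0 → x ∈ C) (hz : z ∈ C) :
    ∃ w ∈ C, (β + 1) • w = β • x + z := by
  by_cases h : β = 0
  · exact ⟨z, hz, by simp [h]⟩
  · have h1 : β + 1 ≠ 0 := by positivity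
    refine ⟨(β / (β + 1)) • x + (1 / (β + 1)) • z,
      hC (hx h) hz (by positivity) (by positivity) (by field_simp), ?_⟩
    rw [smul_add, smul_smul, smul_smul, mul_div_cancel₀ _ h1, mul_div_cancel₀ _ h1, one_smul]

/-- Two distinct points suffice for hinge-loss (SVM) data poisoning: if a vector `v`
is a sum of `ñ` nonzero hinge-loss subgradients
`G = {−y x : y ∈ {−1,+1}, x ∈ F_y, y⟨θ,x⟩ ≤ 1}` over convex per-class feasible slices
`F₊, F₋`, then `v = β₊(−x̃₊) + β₋ x̃₋` for some `x̃₊ ∈ F₊` with `⟨θ,x̃₊⟩ ≤ 1`,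
`x̃₋ ∈ F₋` with `−⟨θ,x̃₋⟩ ≤ 1` (each required only when its weight is nonzero), and
nonnegative weights with `β₊ + β₋ ≤ ñ`. -/
theorem svm_attack_two_distinct_points
    {d : ℕ} (θ : EuclideanSpace ℝ (Fin d))
    (Fp Fm : Set (EuclideanSpace ℝ (Fin d)))
    (hFp : Convex ℝ Fp) (hFm : Convex ℝ Fm)
    (n : ℕ) (g : Fin n → EuclideanSpace ℝ (Fin d))
    (hg : ∀ i, g i ∈ {w : EuclideanSpace ℝ (Fin d) |
        ∃ (y : ℝ) (x : EuclideanSpace ℝ (Fin d)),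
          ((y = 1 ∧ x ∈ Fp) ∨ (y = -1 ∧ x ∈ Fm)) ∧ y * ⟪θ, x⟫ ≤ 1 ∧ w = (-y) • x})
    (v : EuclideanSpace ℝ (Fin d)) (hv : v = ∑ i, g i) :
    ∃ (xp xm : EuclideanSpace ℝ (Fin d)) (βp βm : ℝ),
      0 ≤ βp ∧ 0 ≤ βm ∧ βp + βm ≤ (n : ℝ) ∧
      (βp ≠ 0 → xp ∈ Fp ∧ ⟪θ, xp⟫ ≤ 1) ∧
      (βm ≠ 0 → xm ∈ Fm ∧ -⟪θ, xm⟫ ≤ 1) ∧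
      v = βp • (-xp) + βm • xm := by
  have hCp : Convex ℝ {x | x ∈ Fp ∧ ⟪θ, x⟫ ≤ 1} :=
    hFp.inter (convex_halfSpace_le (innerₛₗ ℝ θ).isLinear 1)
  have hCm : Convex ℝ {x | x ∈ Fm ∧ -⟪θ, x⟫ ≤ 1} :=
    hFm.inter (convex_halfSpace_le (-(innerₛₗ ℝ θ)).isLinear 1)
  subst hv
  induction n with
  | zero => exact ⟨0, 0, 0, 0, by simp⟩
  | succ n ih =>
    obtain ⟨xp, xm, βp, βm, h1, h2, h3, h4, h5, h6⟩ :=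
      ih (fun i => g i.castSucc) (fun i => hg i.castSucc)
    rw [Fin.sum_univ_castSucc, h6]
    obtain ⟨y, x, hy, hyx, hgx⟩ := hg (Fin.last n)
    rw [hgx]
    push_cast
    rcases hy with ⟨rfl, hx⟩ | ⟨rfl, hx⟩
    · obtain ⟨w, hw, hwe⟩ := svm_merge hCp h1 h4 (z := x) ⟨hx, by linarith⟩
      refine ⟨w, xm, βp + 1, βm, by linarith, h2, by linarith, fun _ => hw, h5, ?_⟩
      rw [smul_neg (βp + 1), hwe]
      module
    · obtain ⟨w, hw, hwe⟩ := svm_merge hCm h2 h5 (z := x) ⟨hx, by linarith⟩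
      refine ⟨xp, w, βp, βm + 1, h1, by linarith, by linarith, h4, fun _ => hw, ?_⟩
      rw [hwe]
      module
end

section
/- Fix θ ∈ ℝ^d and convex sets F₊, F₋ ⊆ ℝ^d, and let G = {σ(−y ⟨θ, x⟩)(−y x) : y ∈ {−1, +1}, x ∈ F_y} be the set of logistic-loss gradients at θ over the feasible set, where σ(v) = 1/(1 + exp(−v)). Suppose a vector v ∈ ℝ^d can be written as a sum of ñ elements of G (with repetition allowed). Then there exist x̃₊ ∈ F₊, x̃₋ ∈ F₋, and nonnegative reals β₊, β₋ with β₊ + β₋ ≤ ñ such that v = β₊ σ(−⟨θ, x̃₊⟩)(−x̃₊) + β₋ σ(⟨θ, x̃₋⟩)(x̃₋). In other words, any logistic-regression poisoning attack with ñ points can be replaced by an attack of total weight at most ñ supported on only 2 distinct points, one from each class. -/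
open scoped RealInnerProductSpace

theorem logistic_merge_aux {E ι : Type*} [NormedAddCommGroup E] [InnerProductSpace ℝ E]
    (η : E) (F : Set E) (hF : Convex ℝ F) (s : Finset ι) (x : ι → E) (hx : ∀ i ∈ s, x i ∈ F) :
    ∃ (z : E) (β : ℝ), 0 ≤ β ∧ β ≤ (s.card : ℝ) ∧ (β ≠ 0 → z ∈ F) ∧
      ∑ i ∈ s, (1 / (1 + Real.exp (-(inner ℝ η (x i) : ℝ)))) • x i =
        (β * (1 / (1 + Real.exp (-(inner ℝ η z : ℝ))))) • z := by
  rcases s.eq_empty_or_nonempty with rfl | hs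
  · exact ⟨0, 0, by simp⟩
  set c : ι → ℝ := fun i => 1 / (1 + Real.exp (-(inner ℝ η (x i) : ℝ))) with hc
  have hcpos : ∀ i, 0 < c i := fun i => by simp only [hc]; positivity
  set S : ℝ := ∑ i ∈ s, c i with hS
  have hSpos : 0 < S := Finset.sum_pos (fun i _ => hcpos i) hs
  have hw0 : ∀ i ∈ s, 0 ≤ c i / S := fun i _ => (div_pos (hcpos i) hSpos).le
  have hw1 : ∑ i ∈ s, c i / S = 1 := by
    rw [← Finset.sum_div, ← hS, div_self hSpos.ne']
  set z : E := ∑ i ∈ s, (c i / S) • x i with hz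
  have hzF : z ∈ F := hF.sum_mem hw0 hw1 hx
  have hJ := convexOn_exp.map_sum_le (t := s) (w := fun i => c i / S)
    (p := fun i => -(inner ℝ η (x i) : ℝ)) hw0 hw1 (fun i _ => Set.mem_univ _)
  have hin : ∑ i ∈ s, (c i / S) • (-(inner ℝ η (x i) : ℝ)) = -(inner ℝ η z : ℝ) := by
    rw [hz, inner_sum, ← Finset.sum_neg_distrib]
    refine Finset.sum_congr rfl fun i _ => ?_
    rw [inner_smul_right, smul_eq_mul]; ring
  rw [hin] at hJ
  have hsum : ∑ i ∈ s, (c i / S) • Real.exp (-(inner ℝ η (x i) : ℝ)) = (s.card - S) / S := by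
    have h1 : ∀ i ∈ s, (c i / S) • Real.exp (-(inner ℝ η (x i) : ℝ)) = (1 - c i) / S := by
      intro i _
      have : (1 + Real.exp (-(inner ℝ η (x i) : ℝ))) ≠ 0 := by positivity
      simp only [hc, smul_eq_mul]
      field_simp
      ring
    rw [Finset.sum_congr rfl h1, ← Finset.sum_div, Finset.sum_sub_distrib, ← hS]
    simp
  rw [hsum, le_div_iff₀ hSpos] at hJ
  refine ⟨z, S * (1 + Real.exp (-(inner ℝ η z : ℝ))), by positivity, by linarith,
    fun _ => hzF, ?_⟩
  have hne : (1 + Real.exp (-(inner ℝ η z : ℝ))) ≠ 0 := by positivity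
  rw [mul_assoc, mul_one_div_cancel hne, mul_one, hz, Finset.smul_sum]
  refine Finset.sum_congr rfl fun i _ => ?_
  rw [smul_smul, mul_div_cancel₀ _ hSpos.ne']

/-- Two distinct points suffice for logistic-regression data poisoning: if a vector `v`
is a sum of `ñ` logistic-loss gradients `G = {σ(−y⟨θ,x⟩)(−y x) : y ∈ {−1,+1}, x ∈ F_y}`
(where `σ(v) = 1/(1 + exp(−v))`) over convex per-class feasible slices `F₊, F₋`, then
`v = β₊ σ(−⟨θ,x̃₊⟩)(−x̃₊) + β₋ σ(⟨θ,x̃₋⟩) x̃₋` for some `x̃₊ ∈ F₊`, `x̃₋ ∈ F₋` (each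
required only when its weight is nonzero) and nonnegative weights with `β₊ + β₋ ≤ ñ`. -/
theorem logistic_attack_two_distinct_points
    {d : ℕ} (θ : EuclideanSpace ℝ (Fin d))
    (Fp Fm : Set (EuclideanSpace ℝ (Fin d)))
    (hFp : Convex ℝ Fp) (hFm : Convex ℝ Fm)
    (n : ℕ) (g : Fin n → EuclideanSpace ℝ (Fin d))
    (hg : ∀ i, g i ∈ {w : EuclideanSpace ℝ (Fin d) |
        ∃ (y : ℝ) (x : EuclideanSpace ℝ (Fin d)),
          ((y = 1 ∧ x ∈ Fp) ∨ (y = -1 ∧ x ∈ Fm)) ∧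
          w = (1 / (1 + Real.exp (-(-(y * ⟪θ, x⟫))))) • ((-y) • x)})
    (v : EuclideanSpace ℝ (Fin d)) (hv : v = ∑ i, g i) :
    ∃ (xp xm : EuclideanSpace ℝ (Fin d)) (βp βm : ℝ),
      0 ≤ βp ∧ 0 ≤ βm ∧ βp + βm ≤ (n : ℝ) ∧
      (βp ≠ 0 → xp ∈ Fp) ∧ (βm ≠ 0 → xm ∈ Fm) ∧
      v = (βp * (1 / (1 + Real.exp (-(-⟪θ, xp⟫))))) • (-xp) +
            (βm * (1 / (1 + Real.exp (-⟪θ, xm⟫)))) • xm := by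
  classical
  choose y x hyx hgx using hg
  obtain ⟨xp, βp, hp0, hpc, hpF, hpe⟩ := logistic_merge_aux (-θ) Fp hFp
    (Finset.univ.filter fun i => y i = 1) x (by
      intro i hi
      have hi' : y i = 1 := by simpa using hi
      rcases hyx i with h | h
      · exact h.2
      · have := h.1; linarith)
  obtain ⟨xm, βm, hm0, hmc, hmF, hme⟩ := logistic_merge_aux θ Fm hFm
    (Finset.univ.filter fun i => ¬ y i = 1) x (by
      intro i hi
      have hi' : ¬ y i = 1 := by simpa using hi
      rcases hyx i with h | h
      · exact absurd h.1 hi'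
      · exact h.2)
  refine ⟨xp, xm, βp, βm, hp0, hm0, ?_, hpF, hmF, ?_⟩
  · have h := Finset.card_filter_add_card_filter_not (s := (Finset.univ : Finset (Fin n)))
      (fun i => y i = 1)
    rw [Finset.card_univ, Fintype.card_fin] at h
    have h' : ((Finset.univ.filter fun i => y i = 1).card : ℝ) +
      ((Finset.univ.filter fun i => ¬ y i = 1).card : ℝ) = n := by exact_mod_cast h
    linarith
  · simp only [inner_neg_left] at hpe
    rw [hv, ← Finset.sum_filter_add_sum_filter_not Finset.univ (fun i => y i = 1), smul_neg,
      ← hpe, ← hme, ← Finset.sum_neg_distrib]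
    congr 1
    · refine Finset.sum_congr rfl fun i hi => ?_
      have hi' : y i = 1 := by simpa using hi
      rw [hgx i, hi']
      simp
    · refine Finset.sum_congr rfl fun i hi => ?_
      have hi' : ¬ y i = 1 := by simpa using hi
      have hi2 : y i = -1 := by
        rcases hyx i with h | h
        · exact absurd h.1 hi'
        · exact h.1
      rw [hgx i, hi2]
      simp
end

section
/- Fix k ≥ 2, convex sets F₁, …, F_k ⊆ ℝ^d, and for i ≠ j define G_{i,j} = {α (x^{(j)} − x^{(i)}) : 0 ≤ α ≤ 1, x ∈ F_i} ⊆ ℝ^{kd}, where x^{(i)} ∈ ℝ^{kd} denotes the block vector whose i-th block of d coordinates equals x and whose other blocks are zero. Then each G_{i,j} is convex, and the Carathéodory number of G̃ = ⋃_{i=1}^k ⋃_{j ≠ i} G_{i,j} is at most k(k−1): every point of conv(G̃) is a convex combination of at most k(k−1) points of G̃. -/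
/-- For `i ≠ j`, `Gij F i j` is the set of scaled multi-class SVM subgradients
`{α (x^{(j)} − x^{(i)}) : 0 ≤ α ≤ 1, x ∈ F i} ⊆ (ℝ^d)^k`, where `x^{(i)}` is the
block vector whose `i`-th block equals `x` and whose other blocks vanish. -/
def Gij {d k : ℕ} (F : Fin k → Set (EuclideanSpace ℝ (Fin d))) (i j : Fin k) :
    Set (Fin k → EuclideanSpace ℝ (Fin d)) :=
  {g | ∃ (α : ℝ) (x : EuclideanSpace ℝ (Fin d)), 0 ≤ α ∧ α ≤ 1 ∧ x ∈ F i ∧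
    g = α • (Pi.single j x - Pi.single i x)}

theorem carNumber_aux {ι E : Type*} [Fintype ι] [AddCommGroup E] [Module ℝ E]
    (S : ι → Set E) (hS : ∀ i, Convex ℝ (S i)) (v : E) (hv : v ∈ convexHull ℝ (⋃ i, S i)) :
    ∃ (p : ι → E) (w : ι → ℝ), (∀ m, p m ∈ ⋃ i, S i) ∧ (∀ m, 0 ≤ w m) ∧ (∑ m, w m) = 1 ∧
      v = ∑ m, w m • p m := by
  classical
  have hne : (⋃ i, S i).Nonempty := convexHull_nonempty_iff.1 ⟨v, hv⟩
  obtain ⟨p0, hp0⟩ := hne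
  rw [mem_convexHull_iff_exists_fintype] at hv
  obtain ⟨κ, _, u, z, hu, hu1, hz, rfl⟩ := hv
  have hz' : ∀ a, ∃ i, z a ∈ S i := fun a => Set.mem_iUnion.1 (hz a)
  choose c hc using hz'
  let W : ι → ℝ := fun s => ∑ a with c a = s, u a
  have hW0 : ∀ s, 0 ≤ W s := fun s => Finset.sum_nonneg fun a _ => hu a
  refine ⟨fun s => if W s = 0 then p0 else (W s)⁻¹ • ∑ a with c a = s, u a • z a, W,
    ?_, hW0, ?_, ?_⟩
  · intro s
    by_cases h : W s = 0
    · simpa only [h, if_true] using hp0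
    · simp only [h, if_false]
      refine Set.mem_iUnion.2 ⟨s, ?_⟩
      rw [Finset.smul_sum]
      simp only [smul_smul]
      refine (hS s).sum_mem (fun a _ => mul_nonneg (inv_nonneg.2 (hW0 s)) (hu a)) ?_ ?_
      · rw [← Finset.mul_sum]
        exact inv_mul_cancel₀ h
      · intro a ha
        have := (Finset.mem_filter.1 ha).2
        exact this ▸ hc a
  · rw [← hu1]
    exact Finset.sum_fiberwise _ _ _
  · rw [← Finset.sum_fiberwise _ c]
    refine Finset.sum_congr rfl fun s _ => ?_
    by_cases h : W s = 0
    · simp only [h, zero_smul]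
      refine Finset.sum_eq_zero fun a ha => ?_
      rw [(Finset.sum_eq_zero_iff_of_nonneg fun a _ => hu a).1 h a ha, zero_smul]
    · simp only [h, if_false]
      rw [smul_smul, mul_inv_cancel₀ h, one_smul]

theorem reindex_aux {ι E : Type*} [Fintype ι] [AddCommGroup E] [Module ℝ E] {n : ℕ}
    (hn : Fintype.card ι = n) (S : Set E) (v : E) (p : ι → E) (w : ι → ℝ)
    (hp : ∀ m, p m ∈ S) (hw : ∀ m, 0 ≤ w m) (hw1 : (∑ m, w m) = 1) (hv : v = ∑ m, w m • p m) :
    ∃ (p : Fin n → E) (w : Fin n → ℝ), (∀ m, p m ∈ S) ∧ (∀ m, 0 ≤ w m) ∧ (∑ m, w m) = 1 ∧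
      v = ∑ m, w m • p m := by
  let e := (Fintype.equivFinOfCardEq hn).symm
  refine ⟨fun m => p (e m), fun m => w (e m), fun m => hp _, fun m => hw _, ?_, ?_⟩
  · rw [← hw1]
    exact Equiv.sum_comp e w
  · rw [hv]
    exact (Equiv.sum_comp e fun q => w q • p q).symm

theorem Gij_convex_aux {d k : ℕ} (F : Fin k → Set (EuclideanSpace ℝ (Fin d)))
    (hF : ∀ i, Convex ℝ (F i)) (i j : Fin k) : Convex ℝ (Gij F i j) := by
  rintro _ ⟨α, x, hα, hα1, hx, rfl⟩ _ ⟨β, y, hβ, hβ1, hy, rfl⟩ a b ha hb hab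
  have h1 : 0 ≤ a * α := mul_nonneg ha hα
  have h2 : 0 ≤ b * β := mul_nonneg hb hβ
  by_cases h : a * α + b * β = 0
  · have h3 : a * α = 0 := by linarith
    have h4 : b * β = 0 := by linarith
    refine ⟨0, x, le_rfl, zero_le_one, hx, ?_⟩
    rw [smul_smul, smul_smul, h3, h4]
    simp
  · refine ⟨a * α + b * β, (a * α / (a * α + b * β)) • x + (b * β / (a * α + b * β)) • y,
      by linarith, by nlinarith, ?_, ?_⟩
    · refine hF i hx hy (by positivity) (by positivity) ?_
      field_simp
    · rw [Pi.single_add, Pi.single_add, Pi.single_smul, Pi.single_smul, Pi.single_smul,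
        Pi.single_smul]
      have e1 : (a * α + b * β) * (a * α / (a * α + b * β)) = a * α := mul_div_cancel₀ _ h
      have e2 : (a * α + b * β) * (b * β / (a * α + b * β)) = b * β := mul_div_cancel₀ _ h
      simp only [smul_sub, smul_add, smul_smul, e1, e2]
      abel

theorem card_aux (k : ℕ) :
    Fintype.card {q : Fin k × Fin k // q ∈ (Finset.univ : Finset (Fin k)).offDiag} =
      k * (k - 1) := by
  rw [Fintype.card_coe, Finset.offDiag_card, Finset.card_univ, Fintype.card_fin,
    Nat.mul_sub, mul_one]

theorem union_aux {d k : ℕ} (F : Fin k → Set (EuclideanSpace ℝ (Fin d))) :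
    (⋃ (i : Fin k), ⋃ (j : Fin k), ⋃ (_ : j ≠ i), Gij F i j) =
      ⋃ q : {q : Fin k × Fin k // q ∈ (Finset.univ : Finset (Fin k)).offDiag},
        Gij F q.1.1 q.1.2 := by
  ext g
  simp only [Set.mem_iUnion]
  constructor
  · rintro ⟨i, j, hij, hg⟩
    exact ⟨⟨(i, j), by simpa using hij.symm⟩, hg⟩
  · rintro ⟨⟨⟨i, j⟩, hq⟩, hg⟩
    exact ⟨i, j, by simpa [eq_comm] using hq, hg⟩

/-- For a `k`-class SVM (`k ≥ 2`) with convex per-class feasible slices `F₁, …, F_k`,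
each set `G_{i,j}` of scaled subgradients is convex, and the Carathéodory number of
`G̃ = ⋃_{i} ⋃_{j ≠ i} G_{i,j}` is at most `k(k−1)`: every point of `conv(G̃)` is a
convex combination of at most `k(k−1)` points of `G̃`. -/
theorem multiclass_svm_carNumber_le
    {d : ℕ} (k : ℕ) (hk : 2 ≤ k)
    (F : Fin k → Set (EuclideanSpace ℝ (Fin d)))
    (hF : ∀ i, Convex ℝ (F i)) :
    (∀ i j : Fin k, i ≠ j → Convex ℝ (Gij F i j)) ∧
    ∀ v ∈ convexHull ℝ (⋃ (i : Fin k), ⋃ (j : Fin k), ⋃ (_ : j ≠ i), Gij F i j),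
      ∃ (p : Fin (k * (k - 1)) → (Fin k → EuclideanSpace ℝ (Fin d)))
        (w : Fin (k * (k - 1)) → ℝ),
        (∀ m, p m ∈ ⋃ (i : Fin k), ⋃ (j : Fin k), ⋃ (_ : j ≠ i), Gij F i j) ∧
        (∀ m, 0 ≤ w m) ∧ (∑ m, w m) = 1 ∧ v = ∑ m, w m • p m := by
  refine ⟨fun i j _ => Gij_convex_aux F hF i j, fun v hv => ?_⟩
  rw [union_aux] at hv ⊢
  obtain ⟨p, w, hp, hw, hw1, hv⟩ :=
    carNumber_aux (fun q : {q : Fin k × Fin k // q ∈ (Finset.univ : Finset (Fin k)).offDiag} =>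
      Gij F q.1.1 q.1.2) (fun q => Gij_convex_aux F hF q.1.1 q.1.2) v hv
  exact reindex_aux (card_aux k) _ v p w hp hw hw1 hv
end
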